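/- Outer bound for general access structures (Theorem 2): every achievable rate tuple (R_d)_{d∈𝒟} ∈ C(𝔸) satisfies, for every subset S ⊆ 𝒟, Σ_{d∈S} R_d ≤ min_{A∈𝔸} min_{U∈𝕌} I(Y_S ; X_A, Y_{S^c} | X_U). -/

import Mathlib

open scoped BigOperators
open Finset Filter

noncomputable section

namespace SecretSharing

open scoped Classical

/-! ### Basic Shannon information quantities (base 2) on finite probability spaces -/

variable {Ω : Type*} [Fintype Ω]

/-- `p` is a probability mass function on the finite type `Ω`. -/
def IsPMF (p : Ω → ℝ) : Prop := (∀ ω, 0 ≤ p ω) ∧ ∑ ω : Ω, p ω = 1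

/-- Probability that the random variable `X` takes the value `a` under `p`. -/
def prob (p : Ω → ℝ) {A : Type*} (X : Ω → A) (a : A) : ℝ :=
  ∑ ω : Ω, if X ω = a then p ω else 0

/-- Shannon entropy (in bits) of the random variable `X` under `p`. -/
def ent (p : Ω → ℝ) {A : Type*} [Fintype A] (X : Ω → A) : ℝ :=
  -∑ a : A, prob p X a * Real.logb 2 (prob p X a)

/-- Conditional Shannon entropy `H(X | Y)` in bits. -/
def condEnt (p : Ω → ℝ) {A B : Type*} [Fintype A] [Fintype B]
    (X : Ω → A) (Y : Ω → B) : ℝ :=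
  ent p (fun ω => (X ω, Y ω)) - ent p Y

/-- Mutual information `I(X ; Y)` in bits. -/
def mutInf (p : Ω → ℝ) {A B : Type*} [Fintype A] [Fintype B]
    (X : Ω → A) (Y : Ω → B) : ℝ :=
  ent p X + ent p Y - ent p (fun ω => (X ω, Y ω))

/-- Conditional mutual information `I(X ; Y | Z)` in bits. -/
def condMutInf (p : Ω → ℝ) {A B C : Type*} [Fintype A] [Fintype B] [Fintype C]
    (X : Ω → A) (Y : Ω → B) (Z : Ω → C) : ℝ :=
  condEnt p X Z - condEnt p X (fun ω => (Y ω, Z ω))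

/-! ### The distributed secret-sharing model -/

variable {L D : ℕ} {𝒳 : Fin L → Type} {𝒴 : Fin D → Type}
variable [∀ l, Fintype (𝒳 l)] [∀ d, Fintype (𝒴 d)]

/-- Sample space for one source symbol: the participants' observations and the
sub-dealers' observations. -/
abbrev Base (𝒳 : Fin L → Type) (𝒴 : Fin D → Type) : Type := (∀ l, 𝒳 l) × (∀ d, 𝒴 d)

/-- The i.i.d. product pmf of `p` over `n` source symbols. -/
def iid (p : Base 𝒳 𝒴 → ℝ) (n : ℕ) : (Fin n → Base 𝒳 𝒴) → ℝ :=
  fun ω => ∏ i, p (ω i)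

/-- Observations `X_T` of the set `T` of participants (single symbol). -/
def XT (T : Finset (Fin L)) : Base 𝒳 𝒴 → ∀ l : {l // l ∈ T}, 𝒳 l.1 :=
  fun ω l => ω.1 l.1

/-- Observations `Y_S` of the set `S` of sub-dealers (single symbol). -/
def YS (S : Finset (Fin D)) : Base 𝒳 𝒴 → ∀ d : {d // d ∈ S}, 𝒴 d.1 :=
  fun ω d => ω.2 d.1

/-- Observations `X_T^n` of the set `T` of participants over a block of length `n`. -/
def XTn (T : Finset (Fin L)) (n : ℕ) :
    (Fin n → Base 𝒳 𝒴) → ∀ l : {l // l ∈ T}, Fin n → 𝒳 l.1 :=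
  fun ω l i => (ω i).1 l.1

/-- Cardinality `⌈2^{n R_d}⌉` of the secret alphabet of sub-dealer `d`. -/
def secCard (R : Fin D → ℝ) (n : ℕ) (d : Fin D) : ℕ := ⌈(2:ℝ) ^ ((n : ℝ) * R d)⌉₊

/-- A secret-sharing strategy at blocklength `n` with rates `R`, for the access
structure `𝔸`: public messages, secrets, and decoders for authorized sets. -/
structure Strategy (𝒳 : Fin L → Type) (𝒴 : Fin D → Type)
    (𝔸 : Set (Finset (Fin L))) (R : Fin D → ℝ) (n : ℕ) where
  msgCard : Fin D → ℕ
  encM : ∀ d : Fin D, (Fin n → 𝒴 d) → Fin (msgCard d)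
  encS : ∀ d : Fin D, (Fin n → 𝒴 d) → Fin (secCard R n d)
  dec : ∀ A : Finset (Fin L), A ∈ 𝔸 →
    (∀ l : {l // l ∈ A}, Fin n → 𝒳 l.1) → (∀ d, Fin (msgCard d)) →
      ∀ d, Fin (secCard R n d)

variable {𝔸 : Set (Finset (Fin L))} {R : Fin D → ℝ} {n : ℕ}

/-- The public communication `M_𝒟` as a random variable. -/
def Strategy.Mrv (σ : Strategy 𝒳 𝒴 𝔸 R n) :
    (Fin n → Base 𝒳 𝒴) → ∀ d, Fin (σ.msgCard d) :=
  fun ω d => σ.encM d (fun i => (ω i).2 d)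

/-- The secrets `S_𝒟` as a random variable. -/
def Strategy.Srv (σ : Strategy 𝒳 𝒴 𝔸 R n) :
    (Fin n → Base 𝒳 𝒴) → ∀ d, Fin (secCard R n d) :=
  fun ω d => σ.encS d (fun i => (ω i).2 d)

/-- The estimate `Ŝ_𝒟(A)` computed by the authorized set `A`. -/
def Strategy.ShatRv (σ : Strategy 𝒳 𝒴 𝔸 R n) (A : Finset (Fin L)) (hA : A ∈ 𝔸) :
    (Fin n → Base 𝒳 𝒴) → ∀ d, Fin (secCard R n d) :=
  fun ω => σ.dec A hA (fun l i => (ω i).1 l.1) (σ.Mrv ω)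

/-- Error probability `P[Ŝ_𝒟(A) ≠ S_𝒟]`. -/
def Strategy.err (p : Base 𝒳 𝒴 → ℝ) (σ : Strategy 𝒳 𝒴 𝔸 R n)
    (A : Finset (Fin L)) (hA : A ∈ 𝔸) : ℝ :=
  ∑ ω : Fin n → Base 𝒳 𝒴, if σ.ShatRv A hA ω ≠ σ.Srv ω then iid p n ω else 0

/-- Information leakage `I(S_𝒟 ; M_𝒟, X_U^n)` to the set `U` of participants. -/
def Strategy.leak (p : Base 𝒳 𝒴 → ℝ) (σ : Strategy 𝒳 𝒴 𝔸 R n)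
    (U : Finset (Fin L)) : ℝ :=
  mutInf (iid p n) σ.Srv (fun ω => (σ.Mrv ω, XTn U n ω))

/-- Uniformity defect `log₂|𝒮_𝒟| - H(S_𝒟)`. -/
def Strategy.unif (p : Base 𝒳 𝒴 → ℝ) (σ : Strategy 𝒳 𝒴 𝔸 R n) : ℝ :=
  Real.logb 2 (∏ d, (secCard R n d : ℝ)) - ent (iid p n) σ.Srv

/-- Achievability of the rate tuple `R` for access structure `𝔸` and
unauthorized sets `𝕌`: a sequence of strategies with vanishing error
probability (for every authorized set), vanishing leakage (for every
unauthorized set), and vanishing uniformity defect. -/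
def Achievable (p : Base 𝒳 𝒴 → ℝ) (𝔸 𝕌 : Set (Finset (Fin L)))
    (R : Fin D → ℝ) : Prop :=
  (∀ d, 0 ≤ R d) ∧
  ∃ σ : (n : ℕ) → Strategy 𝒳 𝒴 𝔸 R n,
    (∀ A : Finset (Fin L), ∀ hA : A ∈ 𝔸,
      Tendsto (fun n => (σ n).err p A hA) atTop (nhds 0)) ∧
    (∀ U ∈ 𝕌, Tendsto (fun n => (σ n).leak p U) atTop (nhds 0)) ∧
    Tendsto (fun n => (σ n).unif p) atTop (nhds 0)

/-- `𝔸` is a monotone access structure: nonempty, not containing `∅`, and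
closed under taking supersets. -/
def MonotoneAccess (𝔸 : Set (Finset (Fin L))) : Prop :=
  𝔸.Nonempty ∧ ∅ ∉ 𝔸 ∧ ∀ A ∈ 𝔸, ∀ T : Finset (Fin L), A ⊆ T → T ∈ 𝔸

/-! ### Auxiliary facts on entropies -/

theorem prob_nonneg {p : Ω → ℝ} (hp : IsPMF p) {A : Type*} (X : Ω → A) (a : A) :
    0 ≤ prob p X a :=
  Finset.sum_nonneg fun ω _ => by split_ifs <;> simp [hp.1]

theorem prob_self_ge {p : Ω → ℝ} (hp : IsPMF p) {A : Type*} (X : Ω → A) (ω : Ω) :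
    p ω ≤ prob p X (X ω) := by
  have := Finset.single_le_sum (f := fun ω' => if X ω' = X ω then p ω' else 0)
    (fun ω' _ => by split_ifs <;> simp [hp.1]) (Finset.mem_univ ω)
  simpa [prob] using this

theorem sum_comp_eq (p : Ω → ℝ) {A : Type*} [Fintype A] (X : Ω → A) (g : A → ℝ) :
    ∑ ω, p ω * g (X ω) = ∑ a, prob p X a * g a := by
  simp only [prob, Finset.sum_mul]
  rw [Finset.sum_comm]
  refine Finset.sum_congr rfl fun ω _ => ?_
  simp [ite_mul]

theorem sum_prob {p : Ω → ℝ} (hp : IsPMF p) {A : Type*} [Fintype A] (X : Ω → A) :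
    ∑ a, prob p X a = 1 := by
  have := sum_comp_eq p X (fun _ => 1)
  simpa [hp.2] using this.symm

theorem ent_eq (p : Ω → ℝ) {A : Type*} [Fintype A] (X : Ω → A) :
    ent p X = -∑ ω, p ω * Real.logb 2 (prob p X (X ω)) := by
  rw [ent, sum_comp_eq p X (fun a => Real.logb 2 (prob p X a))]

theorem prob_mono {p : Ω → ℝ} (hp : IsPMF p) {A B : Type*} (X : Ω → A) (Y : Ω → B)
    (h : ∀ ω ω', Y ω = Y ω' → X ω = X ω') (ω : Ω) :
    prob p Y (Y ω) ≤ prob p X (X ω) := by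
  refine Finset.sum_le_sum fun ω' _ => ?_
  by_cases h1 : Y ω' = Y ω
  · simp [h1, h _ _ h1]
  · simp only [h1, if_false]
    split_ifs <;> simp [hp.1]

theorem ent_mono {p : Ω → ℝ} (hp : IsPMF p) {A B : Type*} [Fintype A] [Fintype B]
    (X : Ω → A) (Y : Ω → B) (h : ∀ ω ω', Y ω = Y ω' → X ω = X ω') :
    ent p X ≤ ent p Y := by
  rw [ent_eq, ent_eq]
  refine neg_le_neg (Finset.sum_le_sum fun ω _ => ?_)
  rcases (hp.1 ω).eq_or_lt with h0 | h0
  · simp [← h0]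
  · refine mul_le_mul_of_nonneg_left ?_ h0.le
    exact Real.logb_le_logb_of_le (by norm_num) (h0.trans_le (prob_self_ge hp Y ω))
      (prob_mono hp X Y h ω)

theorem ent_congr {p : Ω → ℝ} (hp : IsPMF p) {A B : Type*} [Fintype A] [Fintype B]
    (X : Ω → A) (Y : Ω → B) (h : ∀ ω ω', Y ω = Y ω' ↔ X ω = X ω') :
    ent p X = ent p Y :=
  le_antisymm (ent_mono hp X Y fun a b => (h a b).1) (ent_mono hp Y X fun a b => (h a b).2)

theorem prob_le_one {p : Ω → ℝ} (hp : IsPMF p) {A : Type*} (X : Ω → A) (a : A) :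
    prob p X a ≤ 1 := by
  rw [← hp.2]
  refine Finset.sum_le_sum fun ω _ => ?_
  split_ifs <;> simp [hp.1]

theorem ent_nonneg {p : Ω → ℝ} (hp : IsPMF p) {A : Type*} [Fintype A] (X : Ω → A) :
    0 ≤ ent p X := by
  rw [ent_eq, neg_nonneg]
  refine Finset.sum_nonpos fun ω _ => ?_
  refine mul_nonpos_of_nonneg_of_nonpos (hp.1 ω) ?_
  exact Real.logb_nonpos (by norm_num) (prob_nonneg hp X _) (prob_le_one hp X _)

/-- Gibbs inequality for conditional entropies. -/
theorem gibbs {p : Ω → ℝ} (hp : IsPMF p) {A B : Type*} [Fintype A] [Fintype B]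
    (X : Ω → A) (W : Ω → B) (Q : A → B → ℝ) (hQ0 : ∀ a b, 0 ≤ Q a b)
    (hQpos : ∀ ω, 0 < p ω → 0 < Q (X ω) (W ω)) (hQ1 : ∀ b, ∑ a, Q a b ≤ 1) :
    ent p (fun ω => (X ω, W ω)) - ent p W ≤ -∑ ω, p ω * Real.logb 2 (Q (X ω) (W ω)) := by
  set XW : Ω → A × B := fun ω => (X ω, W ω) with hXW
  let g : A × B → ℝ := fun c => Q c.1 c.2 * prob p W c.2 / prob p XW c
  have hl2 : 0 < Real.log 2 := Real.log_pos (by norm_num)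
  have key : ∑ ω, p ω * g (XW ω) ≤ 1 := by
    rw [sum_comp_eq p XW g]
    calc ∑ c, prob p XW c * g c ≤ ∑ c : A × B, Q c.1 c.2 * prob p W c.2 := by
          refine Finset.sum_le_sum fun c _ => ?_
          have h1 : 0 ≤ Q c.1 c.2 * prob p W c.2 := mul_nonneg (hQ0 _ _) (prob_nonneg hp _ _)
          rcases eq_or_ne (prob p XW c) 0 with h0 | h0
          · simpa [h0] using h1
          · simp only [g]
            rw [mul_div_cancel₀ _ h0]
      _ = ∑ b, (∑ a, Q a b) * prob p W b := by
          rw [Fintype.sum_prod_type_right]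
          simp [Finset.sum_mul]
      _ ≤ ∑ b, prob p W b := by
          refine Finset.sum_le_sum fun b _ => ?_
          exact mul_le_of_le_one_left (prob_nonneg hp _ _) (hQ1 b)
      _ = 1 := sum_prob hp W
  have pt : ∀ ω, p ω * Real.logb 2 (Q (X ω) (W ω)) + p ω * Real.logb 2 (prob p W (W ω))
      - p ω * Real.logb 2 (prob p XW (XW ω)) ≤ (p ω * g (XW ω) - p ω) / Real.log 2 := by
    intro ω
    rcases (hp.1 ω).eq_or_lt with h0 | h0
    · simp [← h0]
    · have q0 := hQpos ω h0
      have w0 := h0.trans_le (prob_self_ge hp W ω)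
      have x0 := h0.trans_le (prob_self_ge hp XW ω)
      have hg : 0 < g (XW ω) := div_pos (mul_pos q0 w0) x0
      have e : Real.logb 2 (g (XW ω)) = Real.logb 2 (Q (X ω) (W ω)) +
          Real.logb 2 (prob p W (W ω)) - Real.logb 2 (prob p XW (XW ω)) := by
        simp only [g]
        rw [Real.logb_div (mul_pos q0 w0).ne' x0.ne', Real.logb_mul q0.ne' w0.ne']
      have l := Real.log_le_sub_one_of_pos hg
      have : p ω * Real.logb 2 (g (XW ω)) ≤ (p ω * g (XW ω) - p ω) / Real.log 2 := by
        rw [Real.logb, ← mul_div_assoc]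
        refine div_le_div_of_nonneg_right ?_ hl2.le
        nlinarith
      rw [e] at this
      linarith
  have s := Finset.sum_le_sum fun ω (_ : ω ∈ Finset.univ) => pt ω
  rw [← Finset.sum_div, Finset.sum_sub_distrib, Finset.sum_sub_distrib, Finset.sum_add_distrib,
    hp.2] at s
  have : (∑ ω, p ω * g (XW ω) - 1) / Real.log 2 ≤ 0 :=
    div_nonpos_of_nonpos_of_nonneg (by linarith) hl2.le
  rw [ent_eq p XW, ent_eq p W]
  linarith

theorem submod {p : Ω → ℝ} (hp : IsPMF p) {A B C E : Type*} [Fintype A] [Fintype B]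
    [Fintype C] [Fintype E] (X : Ω → A) (Y : Ω → B) (Z : Ω → C) (V : Ω → E)
    (hX : ∀ ω ω', X ω = X ω' → V ω = V ω') (hY : ∀ ω ω', Y ω = Y ω' → V ω = V ω')
    (hZ : ∀ ω ω', X ω = X ω' → Y ω = Y ω' → Z ω = Z ω') :
    ent p Z + ent p V ≤ ent p X + ent p Y := by
  have h1 : ent p Z ≤ ent p (fun ω => (X ω, Y ω)) := ent_mono hp _ _ fun ω ω' h => by
    simp only [Prod.mk.injEq] at h
    exact hZ _ _ h.1 h.2
  -- a map recovering `V` from `Y`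
  have hf : ∃ f : B → Option E, ∀ ω, f (Y ω) = some (V ω) := by
    refine ⟨fun b => if h : ∃ ω, Y ω = b then some (V h.choose) else none, fun ω => ?_⟩
    have h : ∃ ω', Y ω' = Y ω := ⟨ω, rfl⟩
    simp only [h, dif_pos]
    exact congrArg some (hY _ _ h.choose_spec)
  obtain ⟨f, hf⟩ := hf
  have hpV : ∀ ω, prob p (fun ω => some (V ω)) (some (V ω)) = prob p V (V ω) := by
    intro ω; simp [prob]
  have hpXV : ∀ ω, prob p (fun ω => (X ω, some (V ω))) (X ω, some (V ω)) = prob p X (X ω) := by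
    intro ω
    refine Finset.sum_congr rfl fun ω' _ => ?_
    by_cases h : X ω' = X ω
    · simp [h, hX _ _ h]
    · simp [h]
  let Q : A → B → ℝ := fun a b =>
    prob p (fun ω => (X ω, some (V ω))) (a, f b) / prob p (fun ω => some (V ω)) (f b)
  have h2 := gibbs hp X Y Q (fun a b => div_nonneg (prob_nonneg hp _ _) (prob_nonneg hp _ _))
    (fun ω h0 => by
      simp only [Q, hf, hpV, hpXV]
      exact div_pos (h0.trans_le (prob_self_ge hp X ω)) (h0.trans_le (prob_self_ge hp V ω)))
    (fun b => by
      simp only [Q]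
      rw [← Finset.sum_div]
      have : ∑ a, prob p (fun ω => (X ω, some (V ω))) (a, f b)
          = prob p (fun ω => some (V ω)) (f b) := by
        simp only [prob]
        rw [Finset.sum_comm]
        refine Finset.sum_congr rfl fun ω _ => ?_
        by_cases h : some (V ω) = f b <;> simp [h]
      rw [this]
      exact div_self_le_one _)
  have h3 : -∑ ω, p ω * Real.logb 2 (Q (X ω) (Y ω)) = ent p X - ent p V := by
    rw [ent_eq p X, ent_eq p V, neg_sub_neg, ← Finset.sum_sub_distrib, ← Finset.sum_neg_distrib]
    refine Finset.sum_congr rfl fun ω _ => ?_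
    rcases (hp.1 ω).eq_or_lt with h0 | h0
    · simp [← h0]
    · simp only [Q, hf, hpV, hpXV]
      rw [Real.logb_div (h0.trans_le (prob_self_ge hp X ω)).ne'
        (h0.trans_le (prob_self_ge hp V ω)).ne']
      ring
  linarith

theorem ent_le_logb_card {p : Ω → ℝ} (hp : IsPMF p) {A : Type*} [Fintype A] [Nonempty A]
    (X : Ω → A) : ent p X ≤ Real.logb 2 (Fintype.card A) := by
  have hc : (0:ℝ) < Fintype.card A := by exact_mod_cast Fintype.card_pos
  have h := gibbs hp X (fun _ => ()) (fun _ _ => (Fintype.card A : ℝ)⁻¹)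
    (fun _ _ => by positivity) (fun _ _ => by positivity)
    (fun _ => by simp)
  have h0 : ent p (fun _ : Ω => ()) = 0 := by
    rw [ent_eq]; simp [prob, hp.2]
  have h1 : ent p (fun ω => (X ω, ())) = ent p X := ent_congr hp _ _ (by simp)
  rw [h0, h1, ← Finset.sum_mul, hp.2, Real.logb_inv] at h
  linarith

theorem fano {p : Ω → ℝ} (hp : IsPMF p) {A B : Type*} [Fintype A] [DecidableEq A] [Nonempty A] [Fintype B]
    (X : Ω → A) (W : Ω → B) (f : B → A) :
    ent p (fun ω => (X ω, W ω)) - ent p W ≤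
      1 + (∑ ω, if f (W ω) ≠ X ω then p ω else 0) * Real.logb 2 (Fintype.card A) := by
  have hc : (0:ℝ) < Fintype.card A := by exact_mod_cast Fintype.card_pos
  have hc1 : (1:ℝ) ≤ Fintype.card A := by exact_mod_cast Fintype.card_pos
  let Q : A → B → ℝ := fun a b =>
    (if f b = a then 2⁻¹ else 0) + 2⁻¹ * (Fintype.card A : ℝ)⁻¹
  have hQ : ∀ a b, 0 < Q a b := fun a b => by
    simp only [Q]; split_ifs <;> positivity
  have h := gibbs hp X W Q (fun a b => (hQ a b).le) (fun ω _ => hQ _ _)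
    (fun b => by
      simp only [Q, Finset.sum_add_distrib]
      simp
      field_simp
      norm_num)
  refine h.trans ?_
  rw [← hp.2, Finset.sum_mul, ← Finset.sum_add_distrib, ← Finset.sum_neg_distrib]
  refine Finset.sum_le_sum fun ω _ => ?_
  by_cases he : f (W ω) = X ω
  · have : Real.logb 2 (2⁻¹) ≤ Real.logb 2 (Q (X ω) (W ω)) := by
      apply Real.logb_le_logb_of_le (by norm_num) (by norm_num)
      simp only [Q, he, if_true]
      have : 0 < 2⁻¹ * (Fintype.card A : ℝ)⁻¹ := by positivity
      linarith
    rw [Real.logb_inv, Real.logb_self_eq_one (by norm_num)] at this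
    simp only [he, ne_eq, not_true, if_false]
    nlinarith [hp.1 ω]
  · have : Real.logb 2 (Q (X ω) (W ω)) = -1 - Real.logb 2 (Fintype.card A) := by
      simp only [Q, he, if_false, zero_add]
      rw [Real.logb_mul (by norm_num) (by positivity), Real.logb_inv, Real.logb_inv,
        Real.logb_self_eq_one (by norm_num)]
      ring
    rw [this]
    simp only [he, ne_eq, not_false_iff, if_true]
    nlinarith [hp.1 ω]

/-! ### Product laws -/

theorem sum_prod_pi {B : Type*} [Fintype B] (n : ℕ) (F : Fin n → B → ℝ) :
    ∑ ω : Fin n → B, ∏ i, F i (ω i) = ∏ i, ∑ b, F i b := by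
  rw [Finset.prod_univ_sum, Fintype.piFinset_univ]

theorem iid_isPMF {p : Base 𝒳 𝒴 → ℝ} (hp : IsPMF p) (n : ℕ) : IsPMF (iid p n) := by
  refine ⟨fun ω => Finset.prod_nonneg fun i _ => hp.1 _, ?_⟩
  simp only [iid]
  rw [sum_prod_pi n (fun _ => p)]
  simp [hp.2]

theorem prob_iid (p : Base 𝒳 𝒴 → ℝ) (n : ℕ) {A : Type*} (f : Base 𝒳 𝒴 → A)
    (a : Fin n → A) :
    prob (iid p n) (fun ω i => f (ω i)) a = ∏ i, prob p f (a i) := by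
  simp only [prob]
  rw [← sum_prod_pi n (fun i b => if f b = a i then p b else 0)]
  refine Finset.sum_congr rfl fun ω _ => ?_
  by_cases h : ∀ i, f (ω i) = a i
  · rw [if_pos (funext h)]
    simp [h, iid]
  · rw [if_neg (fun h' => h fun i => congrFun h' i)]
    push Not at h
    obtain ⟨i, hi⟩ := h
    exact (Finset.prod_eq_zero (Finset.mem_univ i) (by simp [hi])).symm

theorem iid_marginal {p : Base 𝒳 𝒴 → ℝ} (hp : IsPMF p) (n : ℕ) (g : Base 𝒳 𝒴 → ℝ)
    (i : Fin n) : ∑ ω, iid p n ω * g (ω i) = ∑ b, p b * g b := by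
  have h := sum_prod_pi n (fun j b => if j = i then p b * g b else p b)
  have h1 : ∀ ω : Fin n → Base 𝒳 𝒴,
      ∏ j, (if j = i then p (ω j) * g (ω j) else p (ω j)) = iid p n ω * g (ω i) := by
    intro ω
    have : ∀ j, (if j = i then p (ω j) * g (ω j) else p (ω j))
        = p (ω j) * (if j = i then g (ω j) else 1) := fun j => by split_ifs <;> simp
    simp only [this, Finset.prod_mul_distrib, iid]
    simp
  simp only [h1] at h
  rw [h, Finset.prod_eq_single i]
  · simp
  · intro j _ hj
    simp [hj, hp.2]
  · simp

theorem ent_iid {p : Base 𝒳 𝒴 → ℝ} (hp : IsPMF p) (n : ℕ) {A : Type*} [Fintype A]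
    (f : Base 𝒳 𝒴 → A) :
    ent (iid p n) (fun ω (i : Fin n) => f (ω i)) = n * ent p f := by
  rw [ent_eq, ent_eq]
  have : ∀ ω : Fin n → Base 𝒳 𝒴,
      iid p n ω * Real.logb 2 (prob (iid p n) (fun ω i => f (ω i)) (fun i => f (ω i)))
      = ∑ i, iid p n ω * Real.logb 2 (prob p f (f (ω i))) := by
    intro ω
    rw [prob_iid, ← Finset.mul_sum]
    by_cases h0 : iid p n ω = 0
    · simp [h0]
    · congr 1
      refine Real.logb_prod _ _ fun i _ => ?_
      have hi : p (ω i) ≠ 0 := fun h => h0 (Finset.prod_eq_zero (Finset.mem_univ i) h)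
      exact (lt_of_lt_of_le (lt_of_le_of_ne (hp.1 _) hi.symm) (prob_self_ge hp f _)).ne'
  rw [Finset.sum_congr rfl fun ω _ => this ω, Finset.sum_comm,
    Finset.sum_congr rfl fun i _ =>
      iid_marginal hp n (fun b => Real.logb 2 (prob p f (f b))) i]
  simp

/-! ### The converse at fixed blocklength -/

set_option maxHeartbeats 2000000 in
theorem converse_n {p : Base 𝒳 𝒴 → ℝ} (hp : IsPMF p) (hR : ∀ d, 0 ≤ R d)
    (σ : Strategy 𝒳 𝒴 𝔸 R n) (S : Finset (Fin D)) (A : Finset (Fin L)) (hA : A ∈ 𝔸)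
    (U : Finset (Fin L)) (herr : σ.err p A hA ≤ 1) :
    (1 - σ.err p A hA) * (n * ∑ d ∈ S, R d) ≤ σ.unif p + σ.leak p U + 1 +
      n * condMutInf p (YS S) (fun ω => (XT A ω, YS Sᶜ ω)) (XT U) := by
  have hq := iid_isPMF hp n
  set q := iid p n with hqdef
  have hpos : ∀ d, 0 < secCard R n d := fun d => Nat.ceil_pos.2 (by positivity)
  have : ∀ d, Nonempty (Fin (secCard R n d)) := fun d => ⟨⟨0, hpos d⟩⟩
  let SS : (Fin n → Base 𝒳 𝒴) → ∀ d : {d // d ∈ S}, Fin (secCard R n d.1) :=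
    fun ω d => σ.Srv ω d.1
  let SC : (Fin n → Base 𝒳 𝒴) → ∀ d : {d // d ∈ Sᶜ}, Fin (secCard R n d.1) :=
    fun ω d => σ.Srv ω d.1
  let MC : (Fin n → Base 𝒳 𝒴) → ∀ d : {d // d ∈ Sᶜ}, Fin (σ.msgCard d.1) :=
    fun ω d => σ.Mrv ω d.1
  let M := σ.Mrv
  let Y : (Fin n → Base 𝒳 𝒴) → Fin n → ∀ d : {d // d ∈ S}, 𝒴 d.1 := fun ω i => YS S (ω i)
  let W : (Fin n → Base 𝒳 𝒴) → Fin n → _ := fun ω i => (XT A (ω i), YS Sᶜ (ω i))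
  let V := XTn (𝒳 := 𝒳) (𝒴 := 𝒴) U n
  -- determination facts
  have dYS : ∀ ω ω', Y ω = Y ω' → SS ω = SS ω' := by
    intro ω ω' h
    funext d
    simp only [SS, Strategy.Srv]
    congr 1
    funext i
    exact congrFun (congrFun h i) d
  have dWC : ∀ ω ω', W ω = W ω' → MC ω = MC ω' := by
    intro ω ω' h
    funext d
    simp only [MC, Strategy.Mrv]
    congr 1
    funext i
    exact congrFun (congrArg Prod.snd (congrFun h i)) d
  have dYCM : ∀ ω ω', Y ω = Y ω' → MC ω = MC ω' → M ω = M ω' := by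
    intro ω ω' h h'
    funext d
    by_cases hd : d ∈ S
    · simp only [M, Strategy.Mrv]
      congr 1
      funext i
      exact congrFun (congrFun h i) ⟨d, hd⟩
    · exact congrFun h' ⟨d, by simpa using hd⟩
  have dMC : ∀ ω ω', M ω = M ω' → MC ω = MC ω' := by
    intro ω ω' h
    funext d
    exact congrFun h d.1
  have dS : ∀ ω ω', σ.Srv ω = σ.Srv ω' → SS ω = SS ω' := by
    intro ω ω' h
    funext d
    exact congrFun h d.1
  have dSS : ∀ ω ω', SS ω = SS ω' → SC ω = SC ω' → σ.Srv ω = σ.Srv ω' := by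
    intro ω ω' h h'
    funext d
    by_cases hd : d ∈ S
    · exact congrFun h ⟨d, hd⟩
    · exact congrFun h' ⟨d, by simpa using hd⟩
  -- submodularity steps
  have a1 := submod hq (fun ω => (Y ω, V ω, MC ω)) (fun ω => (SS ω, M ω, W ω, V ω))
    (fun ω => (Y ω, W ω, V ω)) (fun ω => (SS ω, M ω, V ω))
    (by simp only [Prod.mk.injEq]; intro ω ω' h; exact ⟨dYS _ _ h.1, dYCM _ _ h.1 h.2.2, h.2.1⟩)
    (by simp only [Prod.mk.injEq]; intro ω ω' h; exact ⟨h.1, h.2.1, h.2.2.2⟩)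
    (by simp only [Prod.mk.injEq]; intro ω ω' h h'; exact ⟨h.1, h'.2.2.1, h.2.1⟩)
  have a2 := submod hq (fun ω => (Y ω, V ω)) (fun ω => (V ω, MC ω))
    (fun ω => (Y ω, V ω, MC ω)) V
    (by simp only [Prod.mk.injEq]; intro ω ω' h; exact h.2)
    (by simp only [Prod.mk.injEq]; intro ω ω' h; exact h.1)
    (by simp only [Prod.mk.injEq]; intro ω ω' h h'; exact ⟨h.1, h.2, h'.2⟩)
  have a3 := submod hq (fun ω => (W ω, V ω)) (fun ω => (M ω, V ω))
    (fun ω => (M ω, W ω, V ω)) (fun ω => (V ω, MC ω))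
    (by simp only [Prod.mk.injEq]; intro ω ω' h; exact ⟨h.2, dWC _ _ h.1⟩)
    (by simp only [Prod.mk.injEq]; intro ω ω' h; exact ⟨h.2, dMC _ _ h.1⟩)
    (by simp only [Prod.mk.injEq]; intro ω ω' h h'; exact ⟨h'.1, h.1, h.2⟩)
  -- leakage
  have a4 := submod hq (fun ω => (SS ω, M ω, V ω)) σ.Srv
    (fun ω => (σ.Srv ω, M ω, V ω)) SS
    (by simp only [Prod.mk.injEq]; intro ω ω' h; exact h.1) dS
    (by simp only [Prod.mk.injEq]; intro ω ω' h h'; exact ⟨h', h.2⟩)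
  -- uniformity
  have a5 := submod hq SS SC σ.Srv (fun _ => ()) (by simp) (by simp) dSS
  have a5' := ent_nonneg hq (fun _ : Fin n → Base 𝒳 𝒴 => ())
  have a6 := ent_le_logb_card hq SC
  -- Fano
  have a7 := fano hq SS (fun ω => (M ω, W ω, V ω))
    (fun c d => σ.dec A hA (fun l i => (c.2.1 i).1 l) c.1 d.1)
  have herr' : (∑ ω, if (fun d : {d // d ∈ S} =>
      σ.dec A hA (fun l i => (W ω i).1 l) (M ω) d.1) ≠ SS ω then q ω else 0)
      ≤ σ.err p A hA := by
    refine Finset.sum_le_sum fun ω _ => ?_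
    by_cases h : σ.ShatRv A hA ω = σ.Srv ω
    · have : (fun d : {d // d ∈ S} =>
        σ.dec A hA (fun l i => (W ω i).1 l) (M ω) d.1) = SS ω := by
        funext d
        exact congrFun h d.1
      simp [h, this]
    · have h' : (if σ.ShatRv A hA ω ≠ σ.Srv ω then iid p n ω else 0) = q ω := if_pos h
      rw [h']
      by_cases h2 : (fun d : {d // d ∈ S} =>
        σ.dec A hA (fun l i => (W ω i).1 l) (M ω) d.1) = SS ω
      · rw [if_neg (not_not.2 h2)]
        exact hq.1 ω
      · rw [if_pos h2]
  -- cardinalities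
  have cS : ∀ T : Finset (Fin D),
      Real.logb 2 (Fintype.card (∀ d : {d // d ∈ T}, Fin (secCard R n d.1)))
        = ∑ d ∈ T, Real.logb 2 (secCard R n d) := by
    intro T
    rw [Fintype.card_pi]
    push_cast
    rw [Real.logb_prod _ _ fun d _ => by simpa using (hpos d.1).ne']
    simp only [Fintype.card_fin]
    exact Finset.sum_coe_sort T (fun d => Real.logb 2 (secCard R n d : ℝ))
  have cD : Real.logb 2 (∏ d, (secCard R n d : ℝ))
      = ∑ d ∈ S, Real.logb 2 (secCard R n d) + ∑ d ∈ Sᶜ, Real.logb 2 (secCard R n d) := by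
    rw [Real.logb_prod _ _ fun d _ => by simpa using (hpos d).ne', Finset.sum_add_sum_compl]
  have lR : n * ∑ d ∈ S, R d ≤ ∑ d ∈ S, Real.logb 2 (secCard R n d) := by
    rw [Finset.mul_sum]
    refine Finset.sum_le_sum fun d _ => ?_
    rw [Real.le_logb_iff_rpow_le (by norm_num) (by exact_mod_cast hpos d)]
    exact Nat.le_ceil _
  have lR0 : 0 ≤ ∑ d ∈ S, Real.logb 2 (secCard R n d) :=
    Finset.sum_nonneg fun d _ => Real.logb_nonneg (by norm_num) (by exact_mod_cast hpos d)
  -- single-letterization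
  have e1 : ent q (fun ω => (Y ω, V ω)) = n * ent p (fun b => (YS S b, XT U b)) := by
    rw [← ent_iid hp n]
    refine ent_congr hq _ _ fun ω ω' => ?_
    simp only [funext_iff, Prod.mk.injEq, Y, V, XTn, XT, YS]
    exact ⟨fun h => ⟨fun i => (h i).1, fun l i => (h i).2 l⟩,
      fun h i => ⟨h.1 i, fun l => h.2 l i⟩⟩
  have e2 : ent q V = n * ent p (XT (𝒳 := 𝒳) (𝒴 := 𝒴) U) := by
    rw [← ent_iid hp n]
    refine ent_congr hq _ _ fun ω ω' => ?_
    simp only [funext_iff, V, XTn, XT]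
    exact ⟨fun h l i => h i l, fun h i l => h l i⟩
  have e3 : ent q (fun ω => (Y ω, W ω, V ω))
      = n * ent p (fun b => (YS S b, (XT A b, YS Sᶜ b), XT U b)) := by
    rw [← ent_iid hp n]
    refine ent_congr hq _ _ fun ω ω' => ?_
    simp only [funext_iff, Prod.mk.injEq, Y, V, W, XTn, XT, YS]
    exact ⟨fun h => ⟨fun i => (h i).1, fun i => (h i).2.1, fun l i => (h i).2.2 l⟩,
      fun h i => ⟨h.1 i, h.2.1 i, fun l => h.2.2 l i⟩⟩
  have e4 : ent q (fun ω => (W ω, V ω))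
      = n * ent p (fun b => ((XT A b, YS Sᶜ b), XT U b)) := by
    rw [← ent_iid hp n]
    refine ent_congr hq _ _ fun ω ω' => ?_
    simp only [funext_iff, Prod.mk.injEq, V, W, XTn, XT, YS]
    exact ⟨fun h => ⟨fun i => (h i).1, fun l i => (h i).2 l⟩,
      fun h i => ⟨h.1 i, fun l => h.2 l i⟩⟩
  have hu : σ.unif p = Real.logb 2 (∏ d, (secCard R n d : ℝ)) - ent q σ.Srv := rfl
  have hl : σ.leak p U = ent q σ.Srv + ent q (fun ω => (M ω, V ω))
    - ent q (fun ω => (σ.Srv ω, M ω, V ω)) := rfl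
  have hI : n * condMutInf p (YS S) (fun ω => (XT A ω, YS Sᶜ ω)) (XT U)
      = ent q (fun ω => (Y ω, V ω)) - ent q V
        - (ent q (fun ω => (Y ω, W ω, V ω)) - ent q (fun ω => (W ω, V ω))) := by
    rw [e1, e2, e3, e4, condMutInf, condEnt, condEnt]
    ring
  rw [cS] at a6 a7
  have a8 := mul_le_mul_of_nonneg_right herr' lR0
  have a9 := mul_le_mul_of_nonneg_left lR (sub_nonneg.2 herr)
  rw [hI, hu, hl, cD]
  refine a9.trans ?_
  have a7' := a7.trans (add_le_add_right a8 1)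
  linarith

/-- **Theorem 2 (Outer bound for general access structures).** Every achievable
rate tuple satisfies `R_S ≤ min_{A ∈ 𝔸} min_{U ∈ 𝕌} I(Y_S ; X_A, Y_{Sᶜ} | X_U)`
for every `S ⊆ 𝒟`. -/
theorem outer_bound_general
    {L D : ℕ} (hL : 1 ≤ L) (hD : 1 ≤ D)
    {𝒳 : Fin L → Type} {𝒴 : Fin D → Type}
    [∀ l, Fintype (𝒳 l)] [∀ l, Nonempty (𝒳 l)]
    [∀ d, Fintype (𝒴 d)] [∀ d, Nonempty (𝒴 d)]
    (p : Base 𝒳 𝒴 → ℝ) (hp : IsPMF p)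
    (𝔸 : Set (Finset (Fin L))) (h𝔸 : MonotoneAccess 𝔸)
    (R : Fin D → ℝ) (hach : Achievable p 𝔸 𝔸ᶜ R) :
    ∀ S : Finset (Fin D), ∀ A ∈ 𝔸, ∀ U : Finset (Fin L), U ∉ 𝔸 →
      ∑ d ∈ S, R d ≤ condMutInf p (YS S) (fun ω => (XT A ω, YS Sᶜ ω)) (XT U) := by
  intro S A hA U hU
  obtain ⟨hR, σ, herr, hleak, hunif⟩ := hach
  have he := herr A hA
  have hl := hleak U hU
  set I := condMutInf p (YS S) (fun ω => (XT A ω, YS Sᶜ ω)) (XT U) with hI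
  have hinv : Tendsto (fun n : ℕ => ((n : ℝ))⁻¹) atTop (nhds 0) :=
    tendsto_inv_atTop_nhds_zero_nat
  have t1 : Tendsto (fun n : ℕ => (1 - (σ n).err p A hA) * ∑ d ∈ S, R d) atTop
      (nhds ((1 - 0) * ∑ d ∈ S, R d)) := (tendsto_const_nhds.sub he).mul_const _
  have t2 : Tendsto (fun n : ℕ => ((σ n).unif p + (σ n).leak p U + 1) * (n : ℝ)⁻¹ + I) atTop
      (nhds ((0 + 0 + 1) * 0 + I)) :=
    (((hunif.add hl).add tendsto_const_nhds).mul hinv).add tendsto_const_nhds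
  have h := le_of_tendsto_of_tendsto t1 t2 (by
    filter_upwards [he.eventually (ge_mem_nhds zero_lt_one), eventually_gt_atTop 0] with n h1 h0
    have hn : (0:ℝ) < n := by exact_mod_cast h0
    have c := converse_n hp hR (σ n) S A hA U h1
    rw [← hI] at c
    rw [← div_eq_mul_inv, ← sub_le_iff_le_add, le_div_iff₀ hn]
    linarith)
  simpa using h

end SecretSharing
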